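/- arXiv:2208.03272 — 2 statements merged into one kernel-verified Lean document; each statement's English description precedes it below -/
import Mathlib

section
/- Let 𝒞 ⊆ [0,1] be the middle-thirds Cantor set. For each t ∈ (0,1], since the distance set of 𝒞 is [0,1], there exist smallest numbers 𝔠_1(t), 𝔠_2(t) ∈ 𝒞 with 𝔠_2(t) − 𝔠_1(t) = t. Let 1 ≤ a < b be integers and γ^{a,b}(s) = (s^a, s^b) for s ∈ [0,1]. Then the set K^{a,b} = ⋃_{0 < t ≤ 1} ((𝔠_1(t), 𝔠_1(t)) + t·γ^{a,b}([0,1])) has two-dimensional Lebesgue measure zero; in particular, K^{a,b} is a Lebesgue-null subset of ℝ^2 containing a translate of t·γ^{a,b}([0,1]) for every t ∈ (0,1]. -/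
open MeasureTheory Metric Set Function
open scoped ENNReal

noncomputable section

/-- For `t ∈ (0,1]`, the smallest element `𝔠₁(t)` of the Cantor set `𝒞` such that
`𝔠₁(t) + t ∈ 𝒞`. -/
def cantorLeft (t : ℝ) : ℝ := sInf {c : ℝ | c ∈ cantorSet ∧ c + t ∈ cantorSet}

open Filter Topology

/-- The ternary digits of the gasket: `(0,0)`, `(1,0)`, `(0,1)`. -/
def gasketDigit : Fin 3 → ℤ × ℤ := ![(0, 0), (1, 0), (0, 1)]

/-- The expanding affine maps whose inverses generate the gasket. -/
def gasketExpand (i : Fin 3) (p : ℝ × ℝ) : ℝ × ℝ :=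
  (3 * p.1 - 2 * (gasketDigit i).2, 3 * p.2 - 2 * (gasketDigit i).1)

/-- The right-angled Sierpinski gasket with contraction ratio `1/3`: the greatest subset of the
unit square covered by its three contracted copies. -/
def gasket : Set (ℝ × ℝ) :=
  ⋃₀ {A | A ⊆ Icc 0 1 ∧ A ⊆ ⋃ i, gasketExpand i ⁻¹' A}

lemma subset_gasket {A : Set (ℝ × ℝ)} (h₁ : A ⊆ Icc 0 1)
    (h₂ : A ⊆ ⋃ i, gasketExpand i ⁻¹' A) : A ⊆ gasket :=
  subset_sUnion_of_mem ⟨h₁, h₂⟩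

lemma gasket_subset_Icc : gasket ⊆ Icc 0 1 := sUnion_subset fun _ h => h.1

lemma continuous_gasketExpand (i : Fin 3) : Continuous (gasketExpand i) := by
  unfold gasketExpand; fun_prop

lemma gasket_subset_iUnion : gasket ⊆ ⋃ i, gasketExpand i ⁻¹' gasket := by
  refine sUnion_subset fun A hA p hp => ?_
  obtain ⟨i, hi⟩ := mem_iUnion.1 (hA.2 hp)
  exact mem_iUnion.2 ⟨i, subset_gasket hA.1 hA.2 hi⟩

lemma mem_gasket_iff {p : ℝ × ℝ} : p ∈ gasket ↔ ∃ i, gasketExpand i p ∈ gasket := by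
  refine ⟨fun hp => by simpa using gasket_subset_iUnion hp, ?_⟩
  have key : (⋃ i, gasketExpand i ⁻¹' gasket) ⊆ gasket := by
    refine subset_gasket (iUnion_subset fun i p hp => ?_) (iUnion_subset fun i p hp => ?_)
    · have h := gasket_subset_Icc hp
      simp only [gasketExpand, mem_Icc, Prod.le_def, Prod.fst_zero, Prod.snd_zero, Prod.fst_one,
        Prod.snd_one] at h ⊢
      fin_cases i <;> simp [gasketDigit] at h ⊢ <;> grind
    · refine mem_iUnion.2 ⟨i, ?_⟩
      exact gasket_subset_iUnion hp
  rintro ⟨i, hi⟩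
  exact key (mem_iUnion.2 ⟨i, hi⟩)

lemma isCompact_gasket : IsCompact gasket := by
  refine isCompact_Icc.of_isClosed_subset ?_ gasket_subset_Icc
  refine isClosed_of_closure_subset (subset_gasket ?_ ?_)
  · exact closure_minimal gasket_subset_Icc isClosed_Icc
  · refine closure_minimal (gasket_subset_iUnion.trans ?_) ?_
    · exact iUnion_mono fun i => preimage_mono subset_closure
    · exact isClosed_iUnion_of_finite fun i => isClosed_closure.preimage (continuous_gasketExpand i)

lemma zero_mem_gasket : (0 : ℝ × ℝ) ∈ gasket := by
  refine subset_gasket (A := {0}) (by simp) ?_ rfl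
  rintro _ rfl
  exact mem_iUnion.2 ⟨0, by simp [gasketExpand, gasketDigit]⟩

/-- The value `p + q l` of an integer pair. -/
def pairVal (l : ℝ) (h : ℤ × ℤ) : ℝ := h.1 + h.2 * l

/-- The projection of the gasket with ternary digits `0, 1, l`. -/
def gasketProj (l : ℝ) : Set ℝ := (fun p : ℝ × ℝ => (p.2 + p.1 * l) / 2) '' gasket

lemma mem_gasketProj_iff {l x : ℝ} :
    x ∈ gasketProj l ↔ ∃ i, 3 * x - pairVal l (gasketDigit i) ∈ gasketProj l := by
  constructor
  · rintro ⟨p, hp, rfl⟩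
    obtain ⟨i, hi⟩ := mem_gasket_iff.1 hp
    exact ⟨i, _, hi, by simp only [gasketExpand, pairVal]; ring⟩
  · rintro ⟨i, p, hp, h⟩
    refine ⟨((p.1 + 2 * (gasketDigit i).2) / 3, (p.2 + 2 * (gasketDigit i).1) / 3), ?_, ?_⟩
    · refine mem_gasket_iff.2 ⟨i, ?_⟩
      convert hp using 1
      ext <;> simp only [gasketExpand] <;> ring
    · simp only [pairVal] at h ⊢
      linarith

lemma isCompact_gasketProj (l : ℝ) : IsCompact (gasketProj l) :=
  isCompact_gasket.image (by fun_prop)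

lemma gasketProj_nonempty (l : ℝ) : (gasketProj l).Nonempty := ⟨_, 0, zero_mem_gasket, rfl⟩

lemma volume_gasketProj_ne_top (l : ℝ) : volume (gasketProj l) ≠ ∞ :=
  (isCompact_gasketProj l).measure_lt_top.ne

/-- Differences of the integer labels of two distinct words of equal length. -/
inductive WordDiff : ℤ × ℤ → Prop
  | base (i j : Fin 3) : i ≠ j → WordDiff (gasketDigit i - gasketDigit j)
  | step (h : ℤ × ℤ) (i j : Fin 3) :
      WordDiff h → WordDiff (3 • h + gasketDigit i - gasketDigit j)

lemma pairVal_sub (l : ℝ) (g h : ℤ × ℤ) : pairVal l (g - h) = pairVal l g - pairVal l h := by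
  simp [pairVal]; ring

lemma pairVal_step (l : ℝ) (g h k : ℤ × ℤ) :
    pairVal l (3 • g + h - k) = 3 * pairVal l g + pairVal l h - pairVal l k := by
  simp [pairVal]; ring

lemma volume_translate (T : Set ℝ) (a : ℝ) : volume ((fun x => x - a) ⁻¹' T) = volume T := by
  simp only [sub_eq_add_neg, measure_preimage_add_right]

lemma preimage_div_three_gasketProj (l : ℝ) : (fun x => x / 3) ⁻¹' gasketProj l =
    ⋃ i, (fun x => x - pairVal l (gasketDigit i)) ⁻¹' gasketProj l := by
  ext x
  rw [mem_preimage, mem_gasketProj_iff, mem_iUnion]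
  simp only [mem_preimage, mul_div_cancel₀ x (three_ne_zero)]

lemma volume_preimage_div_three (T : Set ℝ) : volume ((fun x => x / 3) ⁻¹' T) = 3 * volume T := by
  have h : (fun x : ℝ => x / 3) = (fun x => x * 3⁻¹) := rfl
  rw [h, Real.volume_preimage_mul_right (by norm_num), inv_inv, abs_of_pos three_pos]
  simp

lemma volume_gasketProj_inter_digit (l : ℝ) {i j : Fin 3} (hij : i ≠ j) :
    volume ((fun x => x - pairVal l (gasketDigit i)) ⁻¹' gasketProj l ∩
      (fun x => x - pairVal l (gasketDigit j)) ⁻¹' gasketProj l) = 0 := by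
  set A : Fin 3 → Set ℝ := fun i => (fun x => x - pairVal l (gasketDigit i)) ⁻¹' gasketProj l
  have hA (i) : volume (A i) = volume (gasketProj l) := volume_translate _ _
  have hm (i) : MeasurableSet (A i) :=
    (isCompact_gasketProj l).measurableSet.preimage (by fun_prop)
  obtain ⟨k, hk⟩ : ∃ k : Fin 3, ∀ m, m = i ∨ m = j ∨ m = k := by
    revert i j; decide
  have h3 : 3 * volume (gasketProj l) ≤ volume (A i ∪ A j) + volume (A k) := by
    rw [← volume_preimage_div_three, preimage_div_three_gasketProj]
    refine (measure_mono (iUnion_subset fun m => ?_)).trans (measure_union_le _ _)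
    rcases hk m with rfl | rfl | rfl <;> intro x hx <;> simp_all [A]
  have h2 := measure_union_add_inter (μ := volume) (A i) (hm j)
  rw [hA, hA] at h2
  have hT := volume_gasketProj_ne_top l
  rw [hA] at h3
  have hu : volume (A i ∪ A j) ≠ ∞ := by
    refine ne_top_of_le_ne_top ?_ (measure_union_le _ _); simp [hA, hT]
  have hi : volume (A i ∩ A j) ≠ ∞ := by
    refine ne_top_of_le_ne_top ?_ (measure_mono inter_subset_left); simp [hA, hT]
  change volume (A i ∩ A j) = 0
  lift volume (A i ∪ A j) to NNReal using hu with u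
  lift volume (A i ∩ A j) to NNReal using hi with v
  lift volume (gasketProj l) to NNReal using hT with t
  norm_cast at *
  have : (3 * t : ℝ) ≤ u + t := by exact_mod_cast h3
  have : (u + v : ℝ) = t + t := by exact_mod_cast h2
  have : (v : ℝ) ≤ 0 := by linarith
  exact le_antisymm (by exact_mod_cast this) bot_le

lemma WordDiff.volume_inter_eq_zero (l : ℝ) {h : ℤ × ℤ} (hh : WordDiff h) :
    volume (gasketProj l ∩ (fun x => x - pairVal l h) ⁻¹' gasketProj l) = 0 := by
  induction hh with
  | base i j hij =>
    rw [← volume_gasketProj_inter_digit l hij,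
      ← volume_translate _ (pairVal l (gasketDigit j)), inter_comm, preimage_inter]
    congr 2
    ext x
    simp only [mem_preimage, pairVal_sub]
    ring_nf
  | step h i j _ ih =>
    rw [← volume_translate _ (pairVal l (gasketDigit j))]
    refine measure_mono_null ?_ ((volume_preimage_div_three _).trans (by rw [ih, mul_zero]))
    rintro x ⟨hx₁, hx₂⟩
    simp only [mem_preimage, pairVal_step] at hx₁ hx₂
    refine ⟨mem_gasketProj_iff.2 ⟨j, by rwa [mul_div_cancel₀ _ (three_ne_zero)]⟩,
      mem_gasketProj_iff.2 ⟨i, ?_⟩⟩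
    convert hx₂ using 1
    ring

lemma exists_pos_forall_volume_inter_ne_zero {T : Set ℝ} (hT : IsCompact T)
    (h0 : volume T ≠ 0) :
    ∃ ε > 0, ∀ h : ℝ, |h| < ε → volume (T ∩ (fun x => x - h) ⁻¹' T) ≠ 0 := by
  have hlt : volume T < 2 * volume T := by
    rw [two_mul]
    exact ENNReal.lt_add_right hT.measure_lt_top.ne h0
  have h := (tendsto_measure_cthickening_of_isCompact (μ := volume) hT).eventually_lt_const hlt
  obtain ⟨ε, hε, hb⟩ := Metric.eventually_nhds_iff.1 h
  refine ⟨ε / 2, by positivity, fun h hh h00 => ?_⟩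
  have hsub : T ∪ (fun x => x - h) ⁻¹' T ⊆ cthickening (ε / 2) T := by
    refine union_subset (self_subset_cthickening T) fun x hx => ?_
    refine mem_cthickening_of_dist_le x (x - h) _ _ hx ?_
    simpa [Real.dist_eq] using hh.le
  have hm : MeasurableSet ((fun x => x - h) ⁻¹' T) := hT.measurableSet.preimage (by fun_prop)
  have h2 := measure_union_add_inter (μ := volume) T hm
  rw [h00, add_zero, volume_translate, ← two_mul] at h2
  have := hb (y := ε / 2) (by rw [Real.dist_eq, sub_zero, abs_of_pos (by positivity)]; linarith)
  exact absurd (h2 ▸ measure_mono hsub) (not_le.2 this)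

lemma volume_thickening_lt {T : Set ℝ} (hT : IsCompact T) (hne : T.Nonempty) {r s : ℝ}
    (hr : 0 < r) (hrs : r < s) : volume (thickening r T) < volume (thickening s T) := by
  obtain ⟨m, hm, hmax⟩ := hT.exists_isGreatest hne
  have hdisj : Disjoint (thickening r T) (Ioo (m + r) (m + s)) := by
    refine disjoint_left.2 fun x hx hx' => ?_
    obtain ⟨y, hy, hxy⟩ := mem_thickening_iff.1 hx
    have := hmax hy
    rw [Real.dist_eq] at hxy
    linarith [le_abs_self (x - y), hx'.1]
  have hsub : thickening r T ∪ Ioo (m + r) (m + s) ⊆ thickening s T := by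
    refine union_subset (thickening_mono hrs.le T) fun x hx => ?_
    refine mem_thickening_iff.2 ⟨m, hm, ?_⟩
    rw [Real.dist_eq, abs_of_pos (by linarith [hx.1])]
    linarith [hx.2]
  have hfin : volume (thickening r T) ≠ ∞ := hT.isBounded.thickening.measure_lt_top.ne
  refine lt_of_lt_of_le ?_ (measure_mono hsub)
  rw [measure_union hdisj measurableSet_Ioo, Real.volume_Ioo]
  exact ENNReal.lt_add_right hfin (by simpa using hrs)

lemma exists_gasketProj_translates_inter_nonempty (l : ℝ) : ∃ i j : Fin 3, i ≠ j ∧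
    ((fun x => x - pairVal l (gasketDigit i)) ⁻¹' gasketProj l ∩
      (fun x => x - pairVal l (gasketDigit j)) ⁻¹' gasketProj l).Nonempty := by
  by_contra! hcon
  set T := gasketProj l with hTdef
  set A : Fin 3 → Set ℝ := fun i => (fun x => x - pairVal l (gasketDigit i)) ⁻¹' T
  have hcl (i) : IsClosed (A i) := (isCompact_gasketProj l).isClosed.preimage (by fun_prop)
  have hco (i) : IsCompact (A i) :=
    (Homeomorph.subRight (pairVal l (gasketDigit i))).isCompact_preimage.2 (isCompact_gasketProj l)
  have hev : ∀ᶠ δ in 𝓝[>] (0 : ℝ), ∀ i j, i ≠ j →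
      Disjoint (thickening δ (A i)) (thickening δ (A j)) := by
    simp only [eventually_all]
    intro i j hij
    obtain ⟨δ, hδ, hd⟩ := Disjoint.exists_thickenings
      (disjoint_iff_inter_eq_empty.2 (hcon i j hij)) (hco i) (hcl j)
    filter_upwards [Ioo_mem_nhdsGT hδ] with ε hε
    exact hd.mono (thickening_mono hε.2.le _) (thickening_mono hε.2.le _)
  obtain ⟨δ, hd, hδ⟩ := (hev.and self_mem_nhdsWithin).exists
  change 0 < δ at hδ
  have htr (i) : (fun x => x - pairVal l (gasketDigit i)) ⁻¹' thickening δ T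
      ⊆ thickening δ (A i) := by
    intro x hx
    obtain ⟨y, hy, hxy⟩ := mem_thickening_iff.1 hx
    refine mem_thickening_iff.2 ⟨y + pairVal l (gasketDigit i), by simpa [A] using hy, ?_⟩
    rw [Real.dist_eq] at hxy ⊢
    convert hxy using 2
    ring
  have hsum : 3 * volume (thickening δ T) ≤ 3 * volume (thickening (δ / 3) T) := by
    calc 3 * volume (thickening δ T) = ∑ _i : Fin 3, volume (thickening δ T) := by simp
      _ ≤ ∑ i : Fin 3, volume (thickening δ (A i)) := by
        refine Finset.sum_le_sum fun i _ => ?_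
        rw [← volume_translate _ (pairVal l (gasketDigit i))]
        exact measure_mono (htr i)
      _ = volume (⋃ i, thickening δ (A i)) := by
        rw [measure_iUnion (fun i j hij => hd i j hij)
          (fun i => isOpen_thickening.measurableSet), tsum_fintype]
      _ ≤ volume ((fun x => x / 3) ⁻¹' thickening (δ / 3) T) := by
        refine measure_mono (iUnion_subset fun i x hx => ?_)
        obtain ⟨y, hy, hxy⟩ := mem_thickening_iff.1 hx
        have hy' : y ∈ (fun x => x / 3) ⁻¹' T := by
          rw [preimage_div_three_gasketProj]
          exact mem_iUnion.2 ⟨i, hy⟩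
        refine mem_thickening_iff.2 ⟨y / 3, hy', ?_⟩
        rw [Real.dist_eq] at hxy ⊢
        rw [← sub_div, abs_div, abs_of_pos (three_pos : (0 : ℝ) < 3)]
        linarith
      _ = _ := volume_preimage_div_three _
  have hlt := volume_thickening_lt (isCompact_gasketProj l) (gasketProj_nonempty l)
    (by positivity : 0 < δ / 3) (by linarith : δ / 3 < δ)
  rw [ENNReal.mul_le_mul_iff_right (by simp) (by simp)] at hsum
  exact absurd hsum (not_le.2 hlt)

lemma exists_wordDiff_pairVal_eq_sub (l : ℝ) (n : ℕ) : ∃ h, WordDiff h ∧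
    (∃ x ∈ gasketProj l, ∃ y ∈ gasketProj l, x + pairVal l h = y) ∧
      (2 ^ n ≤ |h.1| ∨ 2 ^ n ≤ |h.2|) := by
  induction n with
  | zero =>
    obtain ⟨i, j, hij, z, hz₁, hz₂⟩ := exists_gasketProj_translates_inter_nonempty l
    refine ⟨_, .base i j hij, ⟨_, hz₁, _, hz₂, ?_⟩, ?_⟩
    · rw [pairVal_sub]; ring
    · clear hz₁ hz₂; revert i j; decide
  | succ n ih =>
    obtain ⟨h, hh, ⟨x, hx, y, hy, hxy⟩, hn⟩ := ih
    obtain ⟨i, hi⟩ := mem_gasketProj_iff.1 hx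
    obtain ⟨j, hj⟩ := mem_gasketProj_iff.1 hy
    refine ⟨_, hh.step h i j, ⟨_, hi, _, hj, ?_⟩, ?_⟩
    · rw [pairVal_step, ← hxy]; ring
    · have hd : ∀ i j : Fin 3, |(gasketDigit i).1 - (gasketDigit j).1| ≤ 1 ∧
        |(gasketDigit i).2 - (gasketDigit j).2| ≤ 1 := by decide
      obtain ⟨h1, h2⟩ := hd i j
      have h2n : (1 : ℤ) ≤ 2 ^ n := one_le_pow₀ (by norm_num)
      have h3 : (3 • h).1 = 3 * h.1 ∧ (3 • h).2 = 3 * h.2 := by simp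
      simp only [Prod.fst_sub, Prod.snd_sub, Prod.fst_add, Prod.snd_add, h3, pow_succ]
      rw [abs_le] at h1 h2
      simp only [le_abs] at hn ⊢
      omega

lemma exists_wordDiff_abs_snd_large (l : ℝ) : ∃ C > 0, ∀ R : ℝ, ∃ h, WordDiff h ∧
    |pairVal l h| ≤ C ∧ R < |(h.2 : ℝ)| := by
  obtain ⟨M, hM⟩ := (isCompact_gasketProj l).isBounded.exists_norm_le
  have hM0 : 0 ≤ M := (norm_nonneg _).trans (hM _ (gasketProj_nonempty l).choose_spec)
  refine ⟨2 * M + 1, by positivity, fun R => ?_⟩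
  obtain ⟨n, hn⟩ := pow_unbounded_of_one_lt (max R (R * |l| + 2 * M + 1)) (one_lt_two : (1 : ℝ) < 2)
  obtain ⟨h, hh, ⟨x, hx, y, hy, hxy⟩, hbig⟩ := exists_wordDiff_pairVal_eq_sub l n
  have hC : |pairVal l h| ≤ 2 * M + 1 := by
    have h1 := hM x hx
    have h2 := hM y hy
    rw [Real.norm_eq_abs, abs_le] at h1 h2
    rw [abs_le]
    constructor <;> linarith
  refine ⟨h, hh, hC, ?_⟩
  rcases hbig with hb | hb
  · have hb' : (2 : ℝ) ^ n ≤ |(h.1 : ℝ)| := by exact_mod_cast hb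
    have h3 : |(h.1 : ℝ)| ≤ |pairVal l h| + |(h.2 : ℝ)| * |l| := by
      rw [← abs_mul]
      have : (h.1 : ℝ) = pairVal l h - h.2 * l := by simp [pairVal]
      rw [this]
      exact abs_sub _ _
    have h4 : R * |l| < |(h.2 : ℝ)| * |l| := by
      linarith [le_max_right R (R * |l| + 2 * M + 1)]
    exact lt_of_mul_lt_mul_right h4 (abs_nonneg l)
  · have hb' : (2 : ℝ) ^ n ≤ |(h.2 : ℝ)| := by exact_mod_cast hb
    linarith [le_max_left R (R * |l| + 2 * M + 1)]

/-- The parameters at which all labels of word differences stay `ε`-separated from `0`. -/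
def separatedParams (ε : ℝ) : Set ℝ := {l | ∀ h, WordDiff h → ε ≤ |pairVal l h|}

lemma volume_separatedParams {ε : ℝ} (hε : 0 < ε) : volume (separatedParams ε) = 0 := by
  have hae := Besicovitch.ae_tendsto_measure_inter_div volume (separatedParams ε)
  have hfalse : ∀ᵐ l ∂(volume.restrict (separatedParams ε)), False := by
    filter_upwards [hae] with l hl
    obtain ⟨C, hC, hex⟩ := exists_wordDiff_abs_snd_large l
    have hlt : C / (C + ε) < 1 := by rw [div_lt_one (by positivity)]; linarith
    have hev := hl.eventually_const_lt
      (show ENNReal.ofReal (C / (C + ε)) < 1 by simpa using hlt)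
    obtain ⟨r₀, hr₀, hr⟩ := mem_nhdsGT_iff_exists_Ioo_subset.1 hev
    rw [mem_Ioi] at hr₀
    obtain ⟨h, hh, hval, hbig⟩ := hex ((C + ε) / r₀)
    set q : ℝ := |(h.2 : ℝ)| with hq
    have hq0 : 0 < q := lt_trans (by positivity) hbig
    have hq' : (h.2 : ℝ) ≠ 0 := abs_pos.1 hq0
    have hrr : (C + ε) / q < r₀ := by
      rw [div_lt_iff₀ hq0]; rw [div_lt_iff₀ hr₀] at hbig; linarith
    have hgt := hr ⟨show 0 < (C + ε) / q by positivity, hrr⟩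
    set r := (C + ε) / q with hrdef
    have hr0 : 0 < r := by positivity
    set z : ℝ := -h.1 / h.2 with hz
    have hpv (x : ℝ) : |pairVal x h| = q * |x - z| := by
      rw [hq, ← abs_mul, hz]
      congr 1
      simp only [pairVal]
      field_simp
      ring
    have hsub : separatedParams ε ∩ closedBall l r ⊆ closedBall l r \ ball z (ε / q) := by
      rintro x ⟨hx, hxr⟩
      refine ⟨hxr, fun hxz => ?_⟩
      rw [mem_ball, Real.dist_eq, lt_div_iff₀ hq0] at hxz
      have := hx h hh
      rw [hpv] at this
      linarith
    have hin : ball z (ε / q) ⊆ closedBall l r := by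
      intro x hx
      rw [mem_ball, Real.dist_eq] at hx
      rw [mem_closedBall, Real.dist_eq]
      rw [hpv, mul_comm, ← le_div_iff₀ hq0] at hval
      have : r = C / q + ε / q := by rw [hrdef, add_div]
      rw [this]
      calc |x - l| = |(x - z) - (l - z)| := by ring_nf
        _ ≤ |x - z| + |l - z| := abs_sub _ _
        _ ≤ C / q + ε / q := by linarith
    have hvol : volume (separatedParams ε ∩ closedBall l r) ≤ ENNReal.ofReal (2 * (C / q)) := by
      refine (measure_mono hsub).trans ?_
      rw [measure_sdiff hin measurableSet_ball.nullMeasurableSet measure_ball_lt_top.ne,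
        Real.volume_closedBall, Real.volume_ball, ← ENNReal.ofReal_sub _ (by positivity)]
      refine ENNReal.ofReal_le_ofReal (le_of_eq ?_)
      rw [hrdef]; ring
    change ENNReal.ofReal (C / (C + ε)) < _ / _ at hgt
    rw [Real.volume_closedBall,
      ENNReal.lt_div_iff_mul_lt (.inl (by simp [hr0])) (.inl ENNReal.ofReal_ne_top),
      ← ENNReal.ofReal_mul (by positivity)] at hgt
    have hlast := (hgt.trans_le hvol).ne
    refine hlast ?_
    congr 1
    rw [hrdef]
    field_simp
  rw [← Measure.restrict_eq_zero]
  exact ae_eq_bot.1 (eventually_false_iff_eq_bot.1 hfalse)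

/-- Almost every projection of the gasket is Lebesgue null. -/
lemma ae_volume_gasketProj_eq_zero : ∀ᵐ l : ℝ, volume (gasketProj l) = 0 := by
  have h : ∀ᵐ l : ℝ, ∀ n : ℕ, l ∉ separatedParams (1 / ((n : ℝ) + 1)) :=
    ae_all_iff.2 fun n => measure_eq_zero_iff_ae_notMem.1 (volume_separatedParams (by positivity))
  filter_upwards [h] with l hl
  by_contra h0
  obtain ⟨ε, hε, hsep⟩ :=
    exists_pos_forall_volume_inter_ne_zero (isCompact_gasketProj l) h0
  obtain ⟨n, hn⟩ := exists_nat_one_div_lt hε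
  refine hl n fun h hh => ?_
  by_contra! hlt
  exact hsep _ (hlt.trans hn) (hh.volume_inter_eq_zero l)

lemma MeasureTheory.OuterMeasure.le_mul_volume_of_forall_ediam_le (f : OuterMeasure ℝ)
    (V : Set ℝ) {θ : ℝ≥0∞}
    (hθ₀ : θ ≠ 0) (hθ : θ ≠ ∞)
    (h : ∀ E ⊆ V, ∀ n : ℕ, ediam E ≤ 3⁻¹ ^ n → f E ≤ 3⁻¹ ^ n * θ) :
    ∀ E ⊆ V, f E ≤ 3 * θ * volume E := by
  have h3₀ : 3 * θ ≠ 0 := mul_ne_zero three_ne_zero hθ₀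
  have h3 : 3 * θ ≠ ∞ := ENNReal.mul_ne_top (by simp) hθ
  have hle : OuterMeasure.restrict V f ≤
      OuterMeasure.mkMetric ((3 * θ) • fun r : ℝ≥0∞ => r ^ (1 : ℝ)) := by
    refine OuterMeasure.le_mkMetric _ _ 1 one_pos fun s hs => ?_
    have hs' (n : ℕ) (hn : ediam s ≤ 3⁻¹ ^ n) : f (s ∩ V) ≤ 3⁻¹ ^ n * θ :=
      h _ inter_subset_right n ((ediam_mono inter_subset_left).trans hn)
    simp only [OuterMeasure.restrict_apply, Pi.smul_apply, ENNReal.rpow_one, smul_eq_mul]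
    rcases eq_or_ne (ediam s) 0 with h0 | h0
    · have hlim : Tendsto (fun n : ℕ => (3⁻¹ : ℝ≥0∞) ^ n * θ) atTop (𝓝 (0 * θ)) :=
        ENNReal.Tendsto.mul_const
          (ENNReal.tendsto_pow_atTop_nhds_zero_of_lt_one (by simp)) (.inr hθ)
      have : f (s ∩ V) ≤ 0 * θ :=
        le_of_tendsto_of_tendsto' tendsto_const_nhds hlim fun n => hs' n (by simp [h0])
      simpa only [zero_mul, h0, mul_zero] using this
    · have htop : ediam s ≠ ∞ := ne_top_of_le_ne_top ENNReal.one_ne_top hs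
      have hd0 : 0 < (ediam s).toReal := ENNReal.toReal_pos h0 htop
      have hd1 : (ediam s).toReal ≤ 1 := ENNReal.toReal_le_of_le_ofReal zero_le_one (by simpa)
      obtain ⟨n, hn₁, hn₂⟩ := exists_nat_pow_near_of_lt_one hd0 hd1
        (by norm_num : (0 : ℝ) < 3⁻¹) (by norm_num)
      have hcast (m : ℕ) : (3⁻¹ : ℝ≥0∞) ^ m = ENNReal.ofReal (3⁻¹ ^ m) := by
        rw [ENNReal.ofReal_pow (by norm_num), ENNReal.ofReal_inv_of_pos (by norm_num)]
        simp
      refine (hs' n ?_).trans ?_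
      · rw [hcast]; exact (ENNReal.le_ofReal_iff_toReal_le htop (by positivity)).2 hn₂
      · rw [mul_right_comm]
        gcongr
        rw [hcast, ← ENNReal.ofReal_toReal htop,
          ← ENNReal.ofReal_ofNat 3, ← ENNReal.ofReal_mul (by norm_num)]
        refine ENNReal.ofReal_le_ofReal ?_
        rw [pow_succ] at hn₁
        linarith
  intro E hE
  have := hle E
  rw [OuterMeasure.restrict_apply, inter_eq_left.2 hE, OuterMeasure.mkMetric_smul _ h3 h3₀] at this
  refine this.trans (le_of_eq ?_)
  rw [smul_apply, OuterMeasure.coe_mkMetric, ← hausdorffMeasure_real]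
  rfl

lemma MeasureTheory.OuterMeasure.eq_zero_of_forall_locally_le_mul_volume (f : OuterMeasure ℝ)
    {G : Set ℝ}
    (hG : G ⊆ Ioo 0 1)
    (h : ∀ s ∈ G, ∀ c : ℝ≥0∞, c ≠ 0 → ∃ V ∈ 𝓝 s, ∀ E ⊆ V, f E ≤ c * volume E) : f G = 0 := by
  rcases G.eq_empty_or_nonempty with rfl | hne
  · exact f.empty
  refine nonpos_iff_eq_zero.1 (le_of_forall_gt_imp_ge_of_dense fun c hc => ?_)
  have h' : ∀ s, ∃ V, IsOpen V ∧ (s ∈ G → s ∈ V) ∧ ∀ E ⊆ V, f E ≤ c * volume E := by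
    intro s
    by_cases hs : s ∈ G
    · obtain ⟨V, hV, hE⟩ := h s hs c hc.ne'
      obtain ⟨W, hWV, hW, hsW⟩ := _root_.mem_nhds_iff.1 hV
      exact ⟨W, hW, fun _ => hsW, fun E hEW => hE E (hEW.trans hWV)⟩
    · refine ⟨∅, isOpen_empty, fun hs' => absurd hs' hs, fun E hE => ?_⟩
      rw [subset_empty_iff.1 hE]; simp
  choose V hVo hVs hVf using h'
  obtain ⟨t, htG, htc, hcov⟩ := TopologicalSpace.countable_cover_nhdsWithin (s := G) (f := V)
    fun s hs => mem_nhdsWithin_of_mem_nhds ((hVo s).mem_nhds (hVs s hs))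
  have htne : t.Nonempty := by
    rw [nonempty_iff_ne_empty]; rintro rfl
    obtain ⟨x, hx⟩ := hne
    simpa using hcov hx
  obtain ⟨u, rfl⟩ := htc.exists_eq_range htne
  set D : ℕ → Set ℝ := fun k => Ioo 0 1 ∩ disjointed (fun k => V (u k)) k with hD
  have hDm (k) : MeasurableSet (D k) :=
    measurableSet_Ioo.inter (MeasurableSet.disjointed (fun k => (hVo (u k)).measurableSet) k)
  have hsub : G ⊆ ⋃ k, D k := by
    rw [← inter_iUnion, iUnion_disjointed]
    exact subset_inter hG (by simpa using hcov)
  calc f G ≤ ∑' k, f (D k) := (f.mono hsub).trans (measure_iUnion_le _)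
    _ ≤ ∑' k, c * volume (D k) := by
      refine ENNReal.tsum_le_tsum fun k => hVf (u k) _ ?_
      exact inter_subset_right.trans (disjointed_subset _ k)
    _ = c * volume (⋃ k, D k) := by
      rw [ENNReal.tsum_mul_left, measure_iUnion _ hDm]
      exact fun i j hij => ((disjoint_disjointed _ hij).mono inter_subset_right inter_subset_right)
    _ ≤ c * volume (Ioo (0 : ℝ) 1) := by
      gcongr; exact iUnion_subset fun k => inter_subset_left
    _ = c := by simp

lemma exists_gasket_cover (n : ℕ) : ∃ Z : Finset (ℝ × ℝ), (∀ z ∈ Z, z ∈ gasket) ∧ Z.card ≤ 3 ^ n ∧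
    ∀ p ∈ gasket, ∃ z ∈ Z, ∃ q ∈ gasket, p = z + ((3 : ℝ)⁻¹ ^ n) • q := by
  classical
  induction n with
  | zero =>
    exact ⟨{0}, by simp [zero_mem_gasket], by simp, fun p hp => ⟨0, by simp, p, hp, by simp⟩⟩
  | succ n ih =>
    obtain ⟨Z, hZ, hcard, hcov⟩ := ih
    let c : Fin 3 × (ℝ × ℝ) → ℝ × ℝ := fun w =>
      ((w.2.1 + 2 * (gasketDigit w.1).2) / 3, (w.2.2 + 2 * (gasketDigit w.1).1) / 3)
    have hc (i z) : gasketExpand i (c (i, z)) = z := by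
      ext <;> simp only [gasketExpand, c] <;> ring
    refine ⟨(Finset.univ ×ˢ Z).image c, ?_, ?_, ?_⟩
    · simp only [Finset.mem_image, Finset.mem_product, Finset.mem_univ, true_and, Prod.exists,
        forall_exists_index, and_imp]
      rintro _ i x y hz rfl
      exact mem_gasket_iff.2 ⟨i, by rw [hc]; exact hZ _ hz⟩
    · refine Finset.card_image_le.trans ?_
      rw [Finset.card_product, Finset.card_univ, Fintype.card_fin, pow_succ]
      omega
    · intro p hp
      obtain ⟨i, hi⟩ := mem_gasket_iff.1 hp
      obtain ⟨z, hz, q, hq, hpz⟩ := hcov _ hi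
      refine ⟨c (i, z), Finset.mem_image_of_mem _ (by simp [hz]), q, hq, ?_⟩
      have h1 := congrArg Prod.fst hpz
      have h2 := congrArg Prod.snd hpz
      simp only [gasketExpand, Prod.fst_add, Prod.snd_add, Prod.smul_fst, Prod.smul_snd,
        smul_eq_mul] at h1 h2
      ext <;> simp only [c, Prod.fst_add, Prod.snd_add, Prod.smul_fst, Prod.smul_snd,
        smul_eq_mul, pow_succ] <;> linarith

lemma volume_strip {U : Set ℝ} (hU : MeasurableSet U) (x₀ ρ α β c τ : ℝ) (hβ : β ≠ 0)
    (hτ : 0 < τ) :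
    volume {v : ℝ × ℝ | v.1 ∈ closedBall x₀ ρ ∧ (α * v.1 - β * v.2 - c) / τ ∈ U} =
      ENNReal.ofReal (τ / |β|) * volume U * ENNReal.ofReal (2 * ρ) := by
  have hm : MeasurableSet
      {v : ℝ × ℝ | v.1 ∈ closedBall x₀ ρ ∧ (α * v.1 - β * v.2 - c) / τ ∈ U} := by
    refine (measurableSet_closedBall.preimage measurable_fst).inter (hU.preimage ?_)
    fun_prop
  have hfib (x : ℝ) : volume {y : ℝ | (α * x - β * y - c) / τ ∈ U} =
      ENNReal.ofReal (τ / |β|) * volume U := by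
    have : {y : ℝ | (α * x - β * y - c) / τ ∈ U} =
        (fun y => (-β / τ) * y) ⁻¹' ((fun w => w - (c - α * x) / τ) ⁻¹' U) := by
      ext y
      simp only [mem_ofPred_eq, mem_preimage]
      ring_nf
    rw [this, Real.volume_preimage_mul_left (div_ne_zero (neg_ne_zero.2 hβ) hτ.ne'),
      volume_translate, inv_div, abs_div, abs_neg, abs_of_pos hτ]
  rw [Measure.volume_eq_prod, Measure.prod_apply hm]
  calc _ = ∫⁻ x, (closedBall x₀ ρ).indicator (fun _ => ENNReal.ofReal (τ / |β|) * volume U) x := by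
        refine lintegral_congr fun x => ?_
        by_cases hx : x ∈ closedBall x₀ ρ
        · rw [indicator_of_mem hx, ← hfib x]
          congr 1
          ext y
          simp only [mem_preimage, mem_ofPred_eq, hx, true_and]
        · rw [indicator_of_notMem hx]
          convert measure_empty (μ := volume)
          ext y
          simp only [mem_preimage, mem_ofPred_eq, hx, false_and, mem_empty_iff_false]
    _ = _ := by
        rw [lintegral_indicator measurableSet_closedBall, setLIntegral_const,
          Real.volume_closedBall]

/-- The point with parameter `s` on the curve `(X, Y)` scaled by `p.2 - p.1` and translated by
`(p.1, p.1)`. -/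
def curvePoint (X Y : ℝ → ℝ) (p : ℝ × ℝ) (s : ℝ) : ℝ × ℝ :=
  (p.1 + (p.2 - p.1) * X s, p.1 + (p.2 - p.1) * Y s)

/-- The area swept by the curves indexed by the gasket, as a function of the parameter set. -/
def sweptArea (X Y : ℝ → ℝ) : OuterMeasure ℝ :=
  OuterMeasure.map Prod.snd (OuterMeasure.comap
    (fun w : gasket × ℝ => curvePoint X Y w.1 w.2) (volume : Measure (ℝ × ℝ)).toOuterMeasure)

lemma sweptArea_apply (X Y : ℝ → ℝ) (E : Set ℝ) :
    sweptArea X Y E = volume (image2 (curvePoint X Y) gasket E) := by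
  change volume ((fun w : gasket × ℝ => curvePoint X Y w.1 w.2) '' (Prod.snd ⁻¹' E)) = _
  congr 1
  ext v
  constructor
  · rintro ⟨⟨⟨p, hp⟩, s⟩, hs, rfl⟩
    exact ⟨p, hp, s, hs, rfl⟩
  · rintro ⟨p, hp, s, hs, rfl⟩
    exact ⟨⟨⟨p, hp⟩, s⟩, hs, rfl⟩

/-- The projection of the curve points with parameter `s` along the direction `(X', Y')`. -/
def directionProj (X Y : ℝ → ℝ) (X' Y' s : ℝ) : Set ℝ :=
  (fun q => Y' * (curvePoint X Y q s).1 - X' * (curvePoint X Y q s).2) '' gasket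

lemma abs_sub_le_one_of_mem_gasket {p : ℝ × ℝ} (hp : p ∈ gasket) : |p.2 - p.1| ≤ 1 := by
  have h := gasket_subset_Icc hp
  simp only [mem_Icc, Prod.le_def, Prod.fst_zero, Prod.snd_zero, Prod.fst_one, Prod.snd_one] at h
  rw [abs_le]
  constructor <;> linarith [h.1.1, h.1.2, h.2.1, h.2.2]

lemma abs_fst_le_one_of_mem_gasket {p : ℝ × ℝ} (hp : p ∈ gasket) : |p.1| ≤ 1 := by
  have h := gasket_subset_Icc hp
  simp only [mem_Icc, Prod.le_def, Prod.fst_zero, Prod.snd_zero, Prod.fst_one, Prod.snd_one] at h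
  rw [abs_le]
  constructor <;> linarith [h.1.1, h.1.2, h.2.1, h.2.2]

lemma HasStrictDerivAt.eventually_abs_sub_le {g : ℝ → ℝ} {g' s₀ ε : ℝ}
    (hg : HasStrictDerivAt g g' s₀) (hε : 0 < ε) :
    ∀ᶠ w in 𝓝 (s₀, s₀), |g w.1 - g w.2| ≤ (|g'| + ε) * |w.1 - w.2| := by
  have h := (hasStrictDerivAt_iff_hasStrictFDerivAt.1 hg).isLittleO.def hε
  filter_upwards [h] with w hw
  rw [Real.norm_eq_abs, Real.norm_eq_abs, ContinuousLinearMap.toSpanSingleton_apply,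
    smul_eq_mul] at hw
  calc |g w.1 - g w.2| = |(g w.1 - g w.2 - (w.1 - w.2) * g') + g' * (w.1 - w.2)| := by ring_nf
    _ ≤ |g w.1 - g w.2 - (w.1 - w.2) * g'| + |g' * (w.1 - w.2)| := abs_add_le _ _
    _ ≤ _ := by rw [abs_mul]; linarith

lemma exists_nhds_volume_image2_curvePoint_le {X Y : ℝ → ℝ} {X' Y' s₀ : ℝ}
    (hX : HasStrictDerivAt X X' s₀) (hY : HasStrictDerivAt Y Y' s₀) (hX' : X' ≠ 0)
    {ε : ℝ} (hε : 0 < ε) :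
    ∃ V ∈ 𝓝 s₀, ∀ E ⊆ V, ∀ n : ℕ, ediam E ≤ 3⁻¹ ^ n →
      volume (image2 (curvePoint X Y) gasket E) ≤
        3⁻¹ ^ n * (ENNReal.ofReal (2 * (|X'| + |X s₀| + 3) / |X'|) *
          volume (thickening ε (directionProj X Y X' Y' s₀))) := by
  set g : ℝ → ℝ := fun s => Y' * X s - X' * Y s with hg
  have hg' : HasStrictDerivAt g 0 s₀ := by
    have := (hX.const_mul Y').sub (hY.const_mul X')
    rwa [mul_comm Y', sub_self] at this
  have e1 := hX.eventually_abs_sub_le one_pos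
  have e2 := hg'.eventually_abs_sub_le (by positivity : 0 < ε / 4)
  rw [nhds_prod_eq] at e1 e2
  obtain ⟨V, hV, hVe⟩ := (eventually_prod_self_iff (r := fun a b =>
    |X a - X b| ≤ (|X'| + 1) * |a - b| ∧ |g a - g b| ≤ (|(0 : ℝ)| + ε / 4) * |a - b|)).1
      (e1.and e2)
  have hX1 : ∀ᶠ s in 𝓝 s₀, |X s| < |X s₀| + 1 :=
    hX.hasDerivAt.continuousAt.abs.eventually_lt_const (lt_add_one _)
  have hs1 : ∀ᶠ s in 𝓝 s₀, |s - s₀| < 1 := by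
    have : Tendsto (fun s => |s - s₀|) (𝓝 s₀) (𝓝 |s₀ - s₀|) :=
      ((continuous_id.sub continuous_const).abs).tendsto s₀
    exact this.eventually_lt_const (by simp)
  refine ⟨_, inter_mem hV (hX1.and hs1), fun E hE n hn => ?_⟩
  rcases E.eq_empty_or_nonempty with rfl | ⟨s₁, hs₁⟩
  · simp
  have hV₀ : s₀ ∈ V := mem_of_mem_nhds hV
  set τ : ℝ := 3⁻¹ ^ n with hτ
  have hτ0 : 0 < τ := by positivity
  have hτE : (3⁻¹ : ℝ≥0∞) ^ n = ENNReal.ofReal τ := by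
    rw [hτ, ENNReal.ofReal_pow (by norm_num), ENNReal.ofReal_inv_of_pos (by norm_num)]
    simp
  have hdist : ∀ s ∈ E, |s - s₁| ≤ τ := by
    intro s hs
    have := (edist_le_ediam_of_mem hs hs₁).trans hn
    rw [hτE, edist_dist, ENNReal.ofReal_le_ofReal_iff hτ0.le, Real.dist_eq] at this
    exact this
  obtain ⟨Z, hZ, hcard, hcov⟩ := exists_gasket_cover n
  set U := thickening ε (directionProj X Y X' Y' s₀) with hU
  set ρ : ℝ := τ * (|X'| + |X s₀| + 3) with hρ
  set W : ℝ × ℝ → Set (ℝ × ℝ) := fun z =>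
    {v | v.1 ∈ closedBall (curvePoint X Y z s₁).1 ρ ∧
      (Y' * v.1 - X' * v.2 - (Y' * (curvePoint X Y z s₁).1 - X' * (curvePoint X Y z s₁).2)) / τ
        ∈ U} with hW
  have hsub : image2 (curvePoint X Y) gasket E ⊆ ⋃ z ∈ Z, W z := by
    rintro _ ⟨p, hp, s, hs, rfl⟩
    obtain ⟨z, hz, q, hq, rfl⟩ := hcov p hp
    refine mem_iUnion₂.2 ⟨z, hz, ?_, ?_⟩
    · have h1 : |X s - X s₁| ≤ (|X'| + 1) * τ :=
        (hVe s (hE hs).1 s₁ (hE hs₁).1).1.trans (by gcongr; exact hdist s hs)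
      have h2 := abs_sub_le_one_of_mem_gasket (hZ z hz)
      have h3 := abs_sub_le_one_of_mem_gasket hq
      have h4 := abs_fst_le_one_of_mem_gasket hq
      have h5 : |X s| ≤ |X s₀| + 1 := (hE hs).2.1.le
      rw [mem_closedBall, Real.dist_eq]
      simp only [curvePoint, Prod.fst_add, Prod.snd_add, Prod.smul_fst, Prod.smul_snd,
        smul_eq_mul]
      calc _ = |(z.2 - z.1) * (X s - X s₁) + τ * (q.1 + (q.2 - q.1) * X s)| := by
            congr 1; ring
        _ ≤ |z.2 - z.1| * |X s - X s₁| + τ * (|q.1| + |q.2 - q.1| * |X s|) := by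
            refine (abs_add_le _ _).trans ?_
            rw [abs_mul, abs_mul, abs_of_pos hτ0, ← abs_mul (q.2 - q.1)]
            gcongr
            exact abs_add_le _ _
        _ ≤ 1 * ((|X'| + 1) * τ) + τ * (1 + 1 * (|X s₀| + 1)) := by gcongr
        _ = ρ := by rw [hρ]; ring
    · refine mem_thickening_iff.2 ⟨_, mem_image_of_mem _ hq, ?_⟩
      have h1 : |g s - g s₁| ≤ ε / 4 * τ := by
        refine (hVe s (hE hs).1 s₁ (hE hs₁).1).2.trans ?_
        rw [abs_zero, zero_add]
        gcongr
        exact hdist s hs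
      have h2 : |g s - g s₀| ≤ ε / 4 := by
        refine (hVe s (hE hs).1 s₀ hV₀).2.trans ?_
        rw [abs_zero, zero_add]
        exact mul_le_of_le_one_right (by positivity) (hE hs).2.2.le
      have h3 := abs_sub_le_one_of_mem_gasket (hZ z hz)
      have h4 := abs_sub_le_one_of_mem_gasket hq
      rw [Real.dist_eq]
      simp only [curvePoint, Prod.fst_add, Prod.snd_add, Prod.smul_fst, Prod.smul_snd,
        smul_eq_mul]
      calc _ = |(z.2 - z.1) * (g s - g s₁) / τ + (q.2 - q.1) * (g s - g s₀)| := by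
            congr 1
            simp only [hg]
            field_simp
            ring
        _ ≤ |z.2 - z.1| * |g s - g s₁| / τ + |q.2 - q.1| * |g s - g s₀| := by
            refine (abs_add_le _ _).trans ?_
            rw [abs_div, abs_mul, abs_mul, abs_of_pos hτ0]
        _ ≤ 1 * (ε / 4 * τ) / τ + 1 * (ε / 4) := by gcongr
        _ < ε := by field_simp; linarith
  have hWvol (z) : volume (W z) = ENNReal.ofReal (τ / |X'|) * volume U * ENNReal.ofReal (2 * ρ) :=
    volume_strip isOpen_thickening.measurableSet _ _ _ _ _ _ hX' hτ0
  calc volume (image2 (curvePoint X Y) gasket E) ≤ volume (⋃ z ∈ Z, W z) := measure_mono hsub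
    _ ≤ ∑ z ∈ Z, volume (W z) := measure_biUnion_finset_le _ _
    _ = Z.card * (ENNReal.ofReal (τ / |X'|) * volume U * ENNReal.ofReal (2 * ρ)) := by
      simp only [hWvol, Finset.sum_const, nsmul_eq_mul]
    _ ≤ ENNReal.ofReal (3 ^ n) *
        (ENNReal.ofReal (τ / |X'|) * volume U * ENNReal.ofReal (2 * ρ)) := by
      gcongr
      rw [← ENNReal.ofReal_natCast]
      exact ENNReal.ofReal_le_ofReal (by exact_mod_cast hcard)
    _ = ENNReal.ofReal (3 ^ n) * ENNReal.ofReal (τ / |X'|) * ENNReal.ofReal (2 * ρ) *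
        volume U := by ring
    _ = ENNReal.ofReal τ * ENNReal.ofReal (2 * (|X'| + |X s₀| + 3) / |X'|) * volume U := by
      rw [← ENNReal.ofReal_mul (by positivity), ← ENNReal.ofReal_mul (by positivity),
        ← ENNReal.ofReal_mul (by positivity)]
      congr 2
      have : (3 : ℝ) ^ n * τ = 1 := by rw [hτ, ← mul_pow]; norm_num
      rw [hρ]
      calc _ = (3 ^ n * τ) * (τ * (2 * (|X'| + |X s₀| + 3) / |X'|)) := by ring
        _ = _ := by rw [this, one_mul]
    _ = _ := by rw [hτE, mul_assoc]

lemma isCompact_directionProj (X Y : ℝ → ℝ) (X' Y' s : ℝ) :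
    IsCompact (directionProj X Y X' Y' s) :=
  isCompact_gasket.image (by unfold curvePoint; fun_prop)

lemma exists_nhds_sweptArea_le {X Y : ℝ → ℝ} {X' Y' s₀ : ℝ}
    (hX : HasStrictDerivAt X X' s₀) (hY : HasStrictDerivAt Y Y' s₀) (hX' : X' ≠ 0) :
    ∃ V ∈ 𝓝 s₀, ∃ c : ℝ≥0∞, c ≠ ∞ ∧ ∀ E ⊆ V, sweptArea X Y E ≤ c * volume E := by
  obtain ⟨V, hV, hE⟩ := exists_nhds_volume_image2_curvePoint_le hX hY hX' one_pos
  set A := ENNReal.ofReal (2 * (|X'| + |X s₀| + 3) / |X'|) *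
    volume (thickening 1 (directionProj X Y X' Y' s₀)) with hA
  have hfin : A ≠ ∞ := ENNReal.mul_ne_top ENNReal.ofReal_ne_top
    (isCompact_directionProj X Y X' Y' s₀).isBounded.thickening.measure_lt_top.ne
  refine ⟨V, hV, 3 * (A + 1), by finiteness,
    OuterMeasure.le_mul_volume_of_forall_ediam_le _ V (by simp) (by finiteness) ?_⟩
  intro E hEV n hn
  rw [sweptArea_apply]
  exact (hE E hEV n hn).trans (by gcongr; exact le_self_add)

lemma exists_nhds_sweptArea_le_of_volume_directionProj {X Y : ℝ → ℝ} {X' Y' s₀ : ℝ}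
    (hX : HasStrictDerivAt X X' s₀) (hY : HasStrictDerivAt Y Y' s₀) (hX' : X' ≠ 0)
    (h0 : volume (directionProj X Y X' Y' s₀) = 0) {c : ℝ≥0∞} (hc : c ≠ 0) :
    ∃ V ∈ 𝓝 s₀, ∀ E ⊆ V, sweptArea X Y E ≤ c * volume E := by
  wlog hc' : c ≠ ∞ generalizing c
  · obtain ⟨V, hV, h⟩ := this one_ne_zero ENNReal.one_ne_top
    exact ⟨V, hV, fun E hE => (h E hE).trans (by gcongr; simp [not_not.1 hc'])⟩
  set B := ENNReal.ofReal (2 * (|X'| + |X s₀| + 3) / |X'|) with hB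
  have hlim : Tendsto (fun r => B * volume (cthickening r (directionProj X Y X' Y' s₀)))
      (𝓝 0) (𝓝 (B * 0)) := by
    refine ENNReal.Tendsto.const_mul ?_ (.inr ENNReal.ofReal_ne_top)
    rw [← h0]
    exact tendsto_measure_cthickening_of_isCompact (isCompact_directionProj X Y X' Y' s₀)
  have hpos : B * 0 < c / 3 := by rw [mul_zero]; exact ENNReal.div_pos hc (by simp)
  obtain ⟨ε, hεB, hε⟩ := (((hlim.mono_left nhdsWithin_le_nhds).eventually_lt_const hpos).and
    (self_mem_nhdsWithin (s := Ioi (0 : ℝ)))).exists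
  obtain ⟨V, hV, hE⟩ := exists_nhds_volume_image2_curvePoint_le hX hY hX' hε
  refine ⟨V, hV, ?_⟩
  have := OuterMeasure.le_mul_volume_of_forall_ediam_le (sweptArea X Y) V (θ := c / 3)
    (ENNReal.div_pos hc (by simp)).ne' (ENNReal.div_ne_top hc' (by simp)) ?_
  · rwa [ENNReal.mul_div_cancel (by simp) (by simp)] at this
  intro E hEV n hn
  rw [sweptArea_apply]
  refine (hE E hEV n hn).trans ?_
  gcongr
  refine le_trans ?_ hεB.le
  gcongr
  exact thickening_subset_cthickening _ _

lemma volume_inter_preimage_eq_zero_of_deriv_pos {f f' : ℝ → ℝ} {S N : Set ℝ}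
    (hS : MeasurableSet S) (hS' : Convex ℝ S) (hf : ∀ x ∈ S, HasDerivAt f (f' x) x)
    (hpos : ∀ x ∈ S, 0 < f' x) (hfm : Measurable f) (hf'm : Measurable f')
    (hN : volume N = 0) : volume (S ∩ f ⁻¹' N) = 0 := by
  set T := S ∩ f ⁻¹' toMeasurable volume N with hT
  have hTm : MeasurableSet T := hS.inter (hfm (measurableSet_toMeasurable _ _))
  suffices volume T = 0 from
    measure_mono_null (inter_subset_inter_right _ (preimage_mono (subset_toMeasurable _ _))) this
  have hmono : MonotoneOn f S := by
    refine monotoneOn_of_deriv_nonneg hS'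
      (fun x hx => (hf x hx).continuousAt.continuousWithinAt)
      (fun x hx => (hf x (interior_subset hx)).differentiableAt.differentiableWithinAt)
      fun x hx => ?_
    rw [(hf x (interior_subset hx)).deriv]
    exact (hpos x (interior_subset hx)).le
  have h0 : ∫⁻ x in T, ENNReal.ofReal (f' x) = 0 := by
    rw [lintegral_deriv_eq_volume_image_of_monotoneOn hTm
      (fun x hx => (hf x hx.1).hasDerivWithinAt) (hmono.mono inter_subset_left)]
    refine measure_mono_null ?_ ((measure_toMeasurable N).trans hN)
    rintro _ ⟨x, hx, rfl⟩
    exact hx.2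
  by_contra hne
  have := (setLIntegral_pos_iff (μ := volume) (s := T) hf'm.ennreal_ofReal).2 (by
    rwa [inter_eq_right.2 fun x hx => by simpa using hpos x hx.1, pos_iff_ne_zero])
  exact this.ne' h0

/-- The parameter of the gasket projection parallel to the tangent of `(s ^ a, s ^ b)` at `s`. -/
def tangentParam (a b : ℕ) (s : ℝ) : ℝ := (b * s⁻¹ ^ a - a * s⁻¹ ^ b) / (b - a) - 1

lemma hasDerivAt_tangentParam (a b : ℕ) {s : ℝ} (hs : s ≠ 0) :
    HasDerivAt (tangentParam a b)
      ((b * (a * s⁻¹ ^ (a - 1) * -(s ^ 2)⁻¹) - a * (b * s⁻¹ ^ (b - 1) * -(s ^ 2)⁻¹)) / (b - a)) s :=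
  (((((hasDerivAt_inv hs).pow a).const_mul (b : ℝ)).sub
    (((hasDerivAt_inv hs).pow b).const_mul (a : ℝ))).div_const _).sub_const 1

lemma volume_tangentParam_preimage {a b : ℕ} (ha : 1 ≤ a) (hab : a < b) {N : Set ℝ}
    (hN : volume N = 0) : volume (Ioo 0 1 ∩ tangentParam a b ⁻¹' N) = 0 := by
  refine volume_inter_preimage_eq_zero_of_deriv_pos measurableSet_Ioo (convex_Ioo 0 1)
    (fun s hs => hasDerivAt_tangentParam a b hs.1.ne') (fun s hs => ?_)
    (by unfold tangentParam; fun_prop) (by fun_prop) hN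
  have h1 : s⁻¹ ^ (a - 1) < s⁻¹ ^ (b - 1) :=
    pow_lt_pow_right₀ ((one_lt_inv₀ hs.1).2 hs.2) (by omega)
  have h2 : (0 : ℝ) < b - a := sub_pos.2 (by exact_mod_cast hab)
  have h3 : (0 : ℝ) < a := by exact_mod_cast ha
  have h4 : (0 : ℝ) < b := by linarith
  have h5 : 0 < (s ^ 2)⁻¹ := by have := hs.1; positivity
  refine div_pos ?_ h2
  have : 0 < (a : ℝ) * b * (s ^ 2)⁻¹ * (s⁻¹ ^ (b - 1) - s⁻¹ ^ (a - 1)) := by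
    have := sub_pos.2 h1
    positivity
  linarith

lemma volume_directionProj_pow {a b : ℕ} (ha : 1 ≤ a) (hab : a < b) {s : ℝ} (hs : 0 < s)
    (h0 : volume (gasketProj (tangentParam a b s)) = 0) :
    volume (directionProj (fun s => s ^ a) (fun s => s ^ b) (a * s ^ (a - 1)) (b * s ^ (b - 1)) s)
      = 0 := by
  obtain ⟨a, rfl⟩ := Nat.exists_eq_add_of_le' ha
  obtain ⟨k, rfl⟩ := Nat.exists_eq_add_of_lt hab
  have key : directionProj (fun s => s ^ (a + 1)) (fun s => s ^ (a + 1 + k + 1))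
      ((a + 1 : ℕ) * s ^ (a + 1 - 1)) ((a + 1 + k + 1 : ℕ) * s ^ (a + 1 + k + 1 - 1)) s =
      (fun x => (2 * (k + 1) * s ^ (a + a + k + 2) : ℝ) • x) ''
        gasketProj (tangentParam (a + 1) (a + 1 + k + 1) s) := by
    rw [directionProj, gasketProj, image_image]
    refine image_congr fun q _ => ?_
    have hk : (k : ℝ) + 1 ≠ 0 := by positivity
    have h1 : ((a + 1 + k + 1 : ℕ) : ℝ) - ((a + 1 : ℕ) : ℝ) = k + 1 := by push_cast; ring
    simp only [curvePoint, tangentParam, h1, inv_pow, smul_eq_mul, Nat.add_sub_cancel]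
    push_cast
    field_simp
    ring
  rw [key, image_smul, Measure.addHaar_smul, h0, mul_zero]

lemma volume_image2_curvePoint_pow_Ioo {a b : ℕ} (ha : 1 ≤ a) (hab : a < b) :
    volume (image2 (curvePoint (fun s => s ^ a) (fun s => s ^ b)) gasket (Ioo 0 1)) = 0 := by
  rw [← sweptArea_apply]
  set bad := Ioo 0 1 ∩ tangentParam a b ⁻¹' {l | ¬ volume (gasketProj l) = 0} with hbad
  have hbad0 : volume bad = 0 :=
    volume_tangentParam_preimage ha hab ae_volume_gasketProj_eq_zero
  have hX (n : ℕ) (s : ℝ) : HasStrictDerivAt (fun s : ℝ => s ^ n) (n * s ^ (n - 1)) s :=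
    hasStrictDerivAt_pow n s
  have hX' {s : ℝ} (hs : s ∈ Ioo 0 1) : (a : ℝ) * s ^ (a - 1) ≠ 0 :=
    mul_ne_zero (by exact_mod_cast (by omega : a ≠ 0)) (pow_ne_zero _ hs.1.ne')
  rw [← sdiff_union_of_subset (inter_subset_left : bad ⊆ Ioo 0 1), measure_union_null_iff]
  constructor
  · refine OuterMeasure.eq_zero_of_forall_locally_le_mul_volume _ sdiff_subset fun s hs c hc => ?_
    refine exists_nhds_sweptArea_le_of_volume_directionProj (hX a s) (hX b s) (hX' hs.1) ?_ hc
    refine volume_directionProj_pow ha hab hs.1.1 ?_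
    by_contra h
    exact hs.2 ⟨hs.1, h⟩
  · refine measure_null_of_locally_null bad fun s hs => ?_
    obtain ⟨V, hV, c, -, hVc⟩ := exists_nhds_sweptArea_le (hX a s) (hX b s) (hX' hs.1)
    refine ⟨V ∩ bad, inter_mem (mem_nhdsWithin_of_mem_nhds hV) self_mem_nhdsWithin, ?_⟩
    refine nonpos_iff_eq_zero.1 ((hVc _ inter_subset_left).trans ?_)
    rw [measure_mono_null inter_subset_right hbad0, mul_zero]

lemma volume_diagonal_real : volume {v : ℝ × ℝ | v.1 = v.2} = 0 := by
  rw [Measure.volume_eq_prod,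
    Measure.measure_prod_null (measurableSet_eq_fun measurable_fst measurable_snd)]
  refine Eventually.of_forall fun x => ?_
  have : Prod.mk x ⁻¹' {v : ℝ × ℝ | v.1 = v.2} = {x} := by
    ext y; simp [eq_comm]
  simp [this]

lemma volume_image2_curvePoint_pow {a b : ℕ} (ha : 1 ≤ a) (hab : a < b) :
    volume (image2 (curvePoint (fun s => s ^ a) (fun s => s ^ b)) gasket (Icc 0 1)) = 0 := by
  refine measure_mono_null ?_ (measure_union_null (volume_image2_curvePoint_pow_Ioo ha hab)
    volume_diagonal_real)
  rintro _ ⟨p, hp, s, hs, rfl⟩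
  rcases hs.1.eq_or_lt with rfl | h0
  · exact .inr (by simp [curvePoint, zero_pow (by omega : a ≠ 0), zero_pow (by omega : b ≠ 0)])
  rcases hs.2.eq_or_lt with rfl | h1
  · exact .inr (by simp [curvePoint])
  · exact .inl ⟨p, hp, s, ⟨h0, h1⟩, rfl⟩

lemma exists_mem_preCantorSet_add_mem (n : ℕ) {t : ℝ} (ht : |t| ≤ 1) :
    ∃ c ∈ preCantorSet n, c + t ∈ preCantorSet n := by
  induction n generalizing t with
  | zero =>
    rw [abs_le] at ht
    rcases le_total 0 t with h | h
    · exact ⟨0, by simp, by simp [h, ht.2]⟩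
    · exact ⟨-t, ⟨by linarith, by linarith⟩, by simp⟩
  | succ n ih =>
    rw [abs_le] at ht
    by_cases h1 : |3 * t| ≤ 1
    · obtain ⟨c, hc, hct⟩ := ih h1
      exact ⟨c / 3, .inl ⟨c, hc, rfl⟩, .inl ⟨_, hct, by ring⟩⟩
    rcases le_total 0 t with h | h
    · rw [abs_of_nonneg (by linarith)] at h1
      obtain ⟨c, hc, hct⟩ := @ih (3 * t - 2) (by rw [abs_le]; constructor <;> linarith)
      exact ⟨c / 3, .inl ⟨c, hc, rfl⟩, .inr ⟨_, hct, by ring⟩⟩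
    · rw [abs_of_nonpos (by linarith)] at h1
      obtain ⟨c, hc, hct⟩ := @ih (3 * t + 2) (by rw [abs_le]; constructor <;> linarith)
      exact ⟨(2 + c) / 3, .inr ⟨c, hc, rfl⟩, .inl ⟨_, hct, by ring⟩⟩

lemma exists_mem_cantorSet_add_mem {t : ℝ} (ht : |t| ≤ 1) :
    ∃ c ∈ cantorSet, c + t ∈ cantorSet := by
  have hcl (n : ℕ) : IsClosed {c | c ∈ preCantorSet n ∧ c + t ∈ preCantorSet n} :=
    (isClosed_preCantorSet n).inter
      ((isClosed_preCantorSet n).preimage (continuous_id.add continuous_const))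
  obtain ⟨c, hc⟩ := IsCompact.nonempty_iInter_of_sequence_nonempty_isCompact_isClosed
    (fun n => {c | c ∈ preCantorSet n ∧ c + t ∈ preCantorSet n})
    (fun n c hc => ⟨preCantorSet_antitone n.le_succ hc.1, preCantorSet_antitone n.le_succ hc.2⟩)
    (fun n => by
      obtain ⟨c, h⟩ := exists_mem_preCantorSet_add_mem n ht
      exact ⟨c, h⟩)
    (isCompact_Icc.of_isClosed_subset (hcl 0) fun c hc => hc.1) hcl
  rw [mem_iInter] at hc
  exact ⟨c, mem_iInter.2 fun n => (hc n).1, mem_iInter.2 fun n => (hc n).2⟩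

lemma isLeast_cantorLeft {t : ℝ} (ht : |t| ≤ 1) :
    IsLeast {c : ℝ | c ∈ cantorSet ∧ c + t ∈ cantorSet} (cantorLeft t) := by
  refine IsCompact.isLeast_sInf ?_ (exists_mem_cantorSet_add_mem ht)
  exact isCompact_cantorSet.inter_right
    (isClosed_cantorSet.preimage (continuous_id.add continuous_const))

lemma div_three_mem_cantorSet {x : ℝ} (hx : x ∈ cantorSet) : x / 3 ∈ cantorSet := by
  rw [cantorSet_eq_union_halves]
  exact .inl ⟨x, hx, rfl⟩

lemma two_add_div_three_mem_cantorSet {x : ℝ} (hx : x ∈ cantorSet) : (2 + x) / 3 ∈ cantorSet := by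
  rw [cantorSet_eq_union_halves]
  exact .inr ⟨x, hx, rfl⟩

/-- The pairs of points of the Cantor set that are leftmost among the pairs with the same
difference. -/
def leftmostCantorPairs : Set (ℝ × ℝ) :=
  {p | p.1 ∈ cantorSet ∧ p.2 ∈ cantorSet ∧
    ∀ c ∈ cantorSet, c + (p.2 - p.1) ∈ cantorSet → p.1 ≤ c}

lemma leftmostCantorPairs_subset_gasket : leftmostCantorPairs ⊆ gasket := by
  refine subset_gasket ?_ ?_
  · rintro p ⟨h1, h2, -⟩
    have h1 := cantorSet_subset_unitInterval h1
    have h2 := cantorSet_subset_unitInterval h2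
    exact ⟨⟨h1.1, h2.1⟩, ⟨h1.2, h2.2⟩⟩
  · rintro ⟨x, y⟩ ⟨hx, hy, hmin⟩
    dsimp only at hx hy hmin
    have hx' := hx
    have hy' := hy
    rw [cantorSet_eq_union_halves] at hx' hy'
    rcases hx' with ⟨x, hx', rfl⟩ | ⟨x, hx', rfl⟩ <;> rcases hy' with ⟨y, hy', rfl⟩ | ⟨y, hy', rfl⟩
    · refine mem_iUnion.2 ⟨0, ?_⟩
      have : gasketExpand 0 (x / 3, y / 3) = (x, y) := by
        ext <;> simp [gasketExpand, gasketDigit] <;> ring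
      rw [mem_preimage, this]
      refine ⟨hx', hy', fun c hc hcy => ?_⟩
      have := hmin (c / 3) (div_three_mem_cantorSet hc)
        (by convert div_three_mem_cantorSet hcy using 1; ring)
      linarith
    · refine mem_iUnion.2 ⟨1, ?_⟩
      have : gasketExpand 1 (x / 3, (2 + y) / 3) = (x, y) := by
        ext <;> simp [gasketExpand, gasketDigit] <;> ring
      rw [mem_preimage, this]
      refine ⟨hx', hy', fun c hc hcy => ?_⟩
      have := hmin (c / 3) (div_three_mem_cantorSet hc)
        (by convert two_add_div_three_mem_cantorSet hcy using 1; ring)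
      linarith
    · refine mem_iUnion.2 ⟨2, ?_⟩
      have : gasketExpand 2 ((2 + x) / 3, y / 3) = (x, y) := by
        ext <;> simp [gasketExpand, gasketDigit] <;> ring
      rw [mem_preimage, this]
      refine ⟨hx', hy', fun c hc hcy => ?_⟩
      have := hmin ((2 + c) / 3) (two_add_div_three_mem_cantorSet hc)
        (by convert div_three_mem_cantorSet hcy using 1; ring)
      linarith
    · have := hmin (x / 3) (div_three_mem_cantorSet hx')
        (by convert div_three_mem_cantorSet hy' using 1; ring)
      linarith

lemma cantorLeft_mem_gasket {t : ℝ} (ht : |t| ≤ 1) :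
    (cantorLeft t, cantorLeft t + t) ∈ gasket := by
  have h := isLeast_cantorLeft ht
  refine leftmostCantorPairs_subset_gasket ⟨h.1.1, h.1.2, fun c hc hct => h.2 ⟨hc, ?_⟩⟩
  simpa using hct

/-- Kinney-type construction: for integers `1 ≤ a < b` and
`γ^{a,b}(s) = (s^a, s^b)`, the pairs `(𝔠₁(t), 𝔠₂(t) = 𝔠₁(t) + t)` of closest Cantor
points at distance `t` exist for every `t ∈ (0,1]`, and the union
`K^{a,b} = ⋃_{0<t≤1} ((𝔠₁(t),𝔠₁(t)) + t γ^{a,b}([0,1]))` is a Lebesgue-null subset of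
`ℝ²` containing a translate of `t·γ^{a,b}([0,1])` for every `t ∈ (0,1]`. -/
theorem stmt_16 (a b : ℕ) (ha : 1 ≤ a) (hab : a < b) :
    (∀ t ∈ Ioc (0:ℝ) 1,
      IsLeast {c : ℝ | c ∈ cantorSet ∧ c + t ∈ cantorSet} (cantorLeft t)) ∧
    volume (⋃ t ∈ Ioc (0:ℝ) 1,
      (fun s : ℝ => (cantorLeft t + t * s ^ a, cantorLeft t + t * s ^ b)) ''
        Icc (0:ℝ) 1) = 0 ∧
    (∀ t ∈ Ioc (0:ℝ) 1, ∃ v : ℝ × ℝ,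
      (fun s : ℝ => (v.1 + t * s ^ a, v.2 + t * s ^ b)) '' Icc (0:ℝ) 1 ⊆
        ⋃ t ∈ Ioc (0:ℝ) 1,
          (fun s : ℝ => (cantorLeft t + t * s ^ a, cantorLeft t + t * s ^ b)) ''
            Icc (0:ℝ) 1) := by
  have habs {t : ℝ} (ht : t ∈ Ioc (0 : ℝ) 1) : |t| ≤ 1 := by
    rw [abs_of_pos ht.1]
    exact ht.2
  refine ⟨fun t ht => isLeast_cantorLeft (habs ht), ?_, fun t ht => ?_⟩
  · refine measure_mono_null (iUnion₂_subset fun t ht => ?_) (volume_image2_curvePoint_pow ha hab)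
    rintro _ ⟨s, hs, rfl⟩
    exact ⟨_, cantorLeft_mem_gasket (habs ht), s, hs, by simp [curvePoint]⟩
  · exact ⟨(cantorLeft t, cantorLeft t), subset_iUnion₂_of_subset t ht subset_rfl⟩
end
end

section
/- Let 2 ≤ k ≤ d − 1 and let γ : [0,1] → ℝ^d be a smooth curve contained in a k-dimensional linear subspace V_k ⊆ ℝ^d such that γ'(s), …, γ^{(k)}(s) span V_k for every s ∈ [0,1]; let I be a compact subinterval of (0,1). Then there exists a Borel set F ⊆ ℝ^d × (0,∞) with dim_H F > k such that dim_H Γ(F) < k + 1. Consequently the conclusion of the packing theorem (dim_H F > α implies dim_H Γ(F) ≥ α + 1 for α = k) fails for such degenerate curves. -/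
open MeasureTheory Metric Set Function
open scoped ENNReal FourierTransform

noncomputable section

/-- `ℝ^d` modeled as Euclidean space. -/
abbrev Euc (d : ℕ) : Type := EuclideanSpace ℝ (Fin d)

/-- The Bessel potential (Sobolev) norm `‖f‖_{L^p_σ} := ‖(1-Δ)^{σ/2} f‖_{L^p(ℝ^d)}`,
realized on the Fourier side as the `L^p` norm of
`𝓕⁻¹ ((1 + |ξ|²)^{σ/2} 𝓕 f)`. -/
def sobolevNorm (d : ℕ) (σ p : ℝ) (f : Euc d → ℂ) : ℝ≥0∞ :=
  eLpNorm (𝓕⁻ fun ξ : Euc d => (((1 + ‖ξ‖ ^ 2) ^ (σ / 2) : ℝ) : ℂ) * 𝓕 f ξ)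
    (ENNReal.ofReal p) volume

/-- A nonnegative Borel measure `μ` is `α`-dimensional if `μ(B(z,ρ)) ≤ C ρ^α`
for all balls. -/
def IsDimensional {X : Type*} [PseudoMetricSpace X] [MeasurableSpace X]
    (μ : Measure X) (α : ℝ) : Prop :=
  ∃ C : ℝ, ∀ (z : X) (ρ : ℝ), 0 < ρ → μ (Metric.ball z ρ) ≤ ENNReal.ofReal (C * ρ ^ α)

/-- `⟨μ⟩_α := sup_{z,ρ} ρ^{-α} μ(B(z,ρ))`. -/
def fractalBound {X : Type*} [PseudoMetricSpace X] [MeasurableSpace X]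
    (μ : Measure X) (α : ℝ) : ℝ≥0∞ :=
  ⨆ (z : X) (ρ : ℝ) (_ : 0 < ρ), μ (Metric.ball z ρ) / ENNReal.ofReal (ρ ^ α)

/-- A smooth curve `γ` is nondegenerate if `det(γ'(s), γ''(s), …, γ^{(d)}(s)) ≠ 0`
for every `s ∈ [0,1]`. -/
def Nondegenerate (d : ℕ) (γ : ℝ → Euc d) : Prop :=
  ∀ s ∈ Icc (0:ℝ) 1,
    (Matrix.of fun i j : Fin d => iteratedDeriv ((j : ℕ) + 1) γ s i).det ≠ 0

/-- `p(d) := 4` if `d = 2` and `p(d) := 4d - 2` if `d ≥ 3`. -/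
def pexp (d : ℕ) : ℝ := if d = 2 then 4 else 4 * d - 2

section

variable {E : Type*} [NormedAddCommGroup E] [NormedSpace ℝ E] [FiniteDimensional ℝ E]

theorem dimH_submodule (V : Submodule ℝ E) : dimH (V : Set E) = Module.finrank ℝ V := by
  rw [← Real.dimH_univ_eq_finrank V, ← V.subtypeₗᵢ.isometry.dimH_image, image_univ]
  congr 1
  exact Subtype.range_coe.symm

theorem dimH_submodule_prod_Ioi (V : Submodule ℝ E) (c : ℝ) :
    dimH ((V : Set E) ×ˢ Ioi c) = (Module.finrank ℝ V + 1 : ℕ) := by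
  have hiso : Isometry (Prod.map ((↑) : V → E) (id : ℝ → ℝ)) :=
    V.subtypeₗᵢ.isometry.prodMap isometry_id
  have himage : (V : Set E) ×ˢ Ioi c =
      Prod.map ((↑) : V → E) (id : ℝ → ℝ) '' (univ ×ˢ Ioi c) := by
    rw [prodMap_image_prod, image_univ, image_id, Subtype.range_coe_subtype]
    rfl
  have hopen : IsOpen ((univ : Set V) ×ˢ Ioi c) := isOpen_univ.prod isOpen_Ioi
  rw [himage, hiso.dimH_image, Real.dimH_of_nonempty_interior, Module.finrank_prod,
    Module.finrank_self]
  rw [hopen.interior_eq]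
  exact univ_nonempty.prod nonempty_Ioi

end

/-- failure of the packing theorem for degenerate curves: let
`2 ≤ k ≤ d - 1` and let `γ` be a smooth curve contained in a `k`-dimensional linear
subspace `V_k ⊆ ℝ^d` whose derivatives `γ'(s), …, γ^{(k)}(s)` span `V_k` for every
`s ∈ [0,1]`. Then there is a Borel set `F ⊆ ℝ^d × (0,∞)` with `dim_H F > k` and
`dim_H Γ(F) < k + 1`. -/
theorem stmt_19 (d k : ℕ) (hk : 2 ≤ k) (hkd : k ≤ d - 1)
    (V : Submodule ℝ (Euc d)) (hVrank : Module.finrank ℝ V = k)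
    (γ : ℝ → Euc d) (hγsmooth : ContDiff ℝ (⊤ : ℕ∞) γ) (hγV : ∀ s, γ s ∈ V)
    (hspan : ∀ s ∈ Icc (0:ℝ) 1,
      Submodule.span ℝ {v : Euc d | ∃ i : ℕ, 1 ≤ i ∧ i ≤ k ∧ v = iteratedDeriv i γ s}
        = V)
    (a b : ℝ) (h0a : 0 < a) (hab : a ≤ b) (hb1 : b < 1) :
    ∃ F : Set (Euc d × ℝ), MeasurableSet F ∧ (∀ z ∈ F, (0:ℝ) < z.2) ∧
      ENNReal.ofReal (k : ℝ) < dimH F ∧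
      dimH (⋃ z ∈ F, (fun s => z.1 + z.2 • γ s) '' Icc a b) <
        ENNReal.ofReal ((k : ℝ) + 1) := by
  have hΓ : (⋃ z ∈ (V : Set (Euc d)) ×ˢ Ioi (0 : ℝ),
      (fun s => z.1 + z.2 • γ s) '' Icc a b) ⊆ V := by
    simp only [iUnion_subset_iff, image_subset_iff]
    exact fun z hz s _ => V.add_mem hz.1 (V.smul_mem _ (hγV s))
  refine ⟨(V : Set (Euc d)) ×ˢ Ioi (0 : ℝ),
    V.closed_of_finiteDimensional.measurableSet.prod measurableSet_Ioi,
    fun z hz => hz.2, ?_, (dimH_mono hΓ).trans_lt ?_⟩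
  · rw [dimH_submodule_prod_Ioi, hVrank, ENNReal.ofReal_natCast]
    exact_mod_cast k.lt_succ_self
  · rw [dimH_submodule, hVrank, ← Nat.cast_succ, ENNReal.ofReal_natCast]
    exact_mod_cast k.lt_succ_self
end
end
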